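/- Let p ∈ (0,1), a ∈ ℝ, and let Λ be a Lévy measure on ℝ whose Blumenthal–Getoor index satisfies β(Λ) < 1/p. Define the characteristic exponent Ψ(λ) = i·a·λ + ∫_ℝ (e^{iλx} − 1 − iλx·1_{|x|≤1}) Λ(dx) for λ ∈ ℝ. Then: (i) for every λ ∈ ℝ the series ∑_{k=1}^∞ f_p(k)·Ψ(kλ) converges absolutely, where f_p(k) = p^{-1} B(k, 1/p + 1) is the Yule–Simon mass function; and (ii) there exists a probability measure μ̂ on ℝ whose characteristic function satisfies ∫_ℝ e^{iλx} μ̂(dx) = exp( (1−p) ∑_{k=1}^∞ f_p(k)·Ψ(kλ) ) for all λ ∈ ℝ. (μ̂ is the law at time 1 of the noise reinforced Lévy process with characteristics (a, 0, Λ, p).) -/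

import Mathlib

open MeasureTheory

/-- The Yule–Simon mass function with parameter `1/p`:
`f_p(k) = p⁻¹ B(k, 1/p + 1)` where `B(x,y) = Γ(x)Γ(y)/Γ(x+y)`. -/
noncomputable def yuleSimonPMF (p : ℝ) (k : ℕ) : ℝ :=
  p⁻¹ * (Real.Gamma k * Real.Gamma (1 / p + 1) / Real.Gamma ((k : ℝ) + 1 / p + 1))

/-- The Blumenthal–Getoor index of a measure `Λ` on `ℝ`:
`β(Λ) = inf { r > 0 : ∫_{[-1,1]} |x|^r Λ(dx) < ∞ }`. -/
noncomputable def bgIndex (Λ : Measure ℝ) : ℝ :=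
  sInf {r : ℝ | 0 < r ∧ ∫⁻ x in Set.Icc (-1 : ℝ) 1, ENNReal.ofReal (|x| ^ r) ∂Λ < ⊤}

open Filter Topology

/-- `f` is the characteristic function of some probability measure on `ℝ`. -/
def IsCharFun (f : ℝ → ℂ) : Prop :=
  ∃ μ : Measure ℝ, IsProbabilityMeasure μ ∧ charFun μ = f

namespace IsCharFun

theorem mul {f g : ℝ → ℂ} (hf : IsCharFun f) (hg : IsCharFun g) :
    IsCharFun (fun l => f l * g l) := by
  obtain ⟨μ, hμ, rfl⟩ := hf
  obtain ⟨ν, hν, rfl⟩ := hg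
  exact ⟨μ.conv ν, inferInstance, funext fun l => charFun_conv l⟩

theorem exp_mul_I (a : ℝ) : IsCharFun (fun l => Complex.exp (Complex.I * a * l)) := by
  refine ⟨Measure.dirac a, inferInstance, funext fun l => ?_⟩
  rw [charFun_dirac]
  congr 1
  simp
  ring

theorem one : IsCharFun (fun _ => 1) := by
  simpa using exp_mul_I 0

theorem pow {f : ℝ → ℂ} (hf : IsCharFun f) (n : ℕ) : IsCharFun (fun l => f l ^ n) := by
  induction n with
  | zero => simpa using one
  | succ n ih => simpa only [pow_succ] using ih.mul hf

theorem prod {ι : Type*} (s : Finset ι) {f : ι → ℝ → ℂ} (hf : ∀ i ∈ s, IsCharFun (f i)) :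
    IsCharFun (fun l => ∏ i ∈ s, f i l) := by
  classical
  induction s using Finset.induction_on with
  | empty => simpa using one
  | insert i s his ih =>
    simp only [Finset.prod_insert his]
    exact (hf i (by simp)).mul (ih fun j hj => hf j (by simp [hj]))

theorem comp_mul {f : ℝ → ℂ} (hf : IsCharFun f) (k : ℝ) : IsCharFun (fun l => f (k * l)) := by
  obtain ⟨μ, hμ, rfl⟩ := hf
  refine ⟨μ.map (k * ·), Measure.isProbabilityMeasure_map (by fun_prop), funext fun l => ?_⟩
  exact charFun_map_mul k l

/-- A pointwise limit of characteristic functions which is continuous at `0` is a characteristic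
function. -/
theorem of_tendsto {F : ℕ → ℝ → ℂ} {f : ℝ → ℂ} (hF : ∀ᶠ n in atTop, IsCharFun (F n))
    (h : ∀ l, Tendsto (fun n => F n l) atTop (𝓝 (f l))) (hf : ContinuousAt f 0) :
    IsCharFun f := by
  obtain ⟨N, hN⟩ := eventually_atTop.1 hF
  choose μ hμ hμF using fun n : ℕ => hN (n + N) (Nat.le_add_left N n)
  have h' : ∀ l, Tendsto (fun n => charFun (μ n) l) atTop (𝓝 (f l)) := fun l => by
    simp only [hμF]
    exact (h l).comp (tendsto_add_atTop_nat N)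
  have tight := isTightMeasureSet_of_tendsto_charFun hf h'
  let P : ℕ → ProbabilityMeasure ℝ := fun n => ⟨μ n, hμ n⟩
  have hc : IsCompact (closure (Set.range P)) := by
    apply isCompact_closure_of_isTightMeasureSet
    convert tight using 1
    ext ν
    exact Set.exists_range_iff
  obtain ⟨ν, -, hν⟩ := hc.ultrafilter_le_nhds ((hyperfilter ℕ).map P)
    (.trans (by simp) (monotone_principal subset_closure))
  have hν' : Tendsto P (hyperfilter ℕ : Filter ℕ) (𝓝 ν) := hν
  refine ⟨ν, inferInstance, funext fun l => ?_⟩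
  have hU : (hyperfilter ℕ : Filter ℕ) ≤ atTop := Nat.hyperfilter_le_atTop
  refine tendsto_nhds_unique ?_ ((h' l).mono_left hU)
  rw [ProbabilityMeasure.tendsto_iff_forall_integral_rclike_tendsto ℂ] at hν'
  simp_rw [charFun_eq_integral_innerProbChar]
  exact hν' (BoundedContinuousFunction.innerProbChar l)

/-- The compound Poisson distributions. -/
theorem exp_charFun_sub (ν : Measure ℝ) [IsFiniteMeasure ν] :
    IsCharFun (fun l => Complex.exp (charFun ν l - ν.real Set.univ)) := by
  refine of_tendsto (F := fun n l => (1 + (charFun ν l - ν.real Set.univ) / n) ^ n) ?_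
    (fun l => Complex.tendsto_one_add_div_pow_exp _) ?_
  · obtain ⟨N, hN⟩ := exists_nat_ge (ν.real Set.univ)
    filter_upwards [eventually_ge_atTop N, eventually_gt_atTop 0] with n hn hn0
    refine pow (f := fun l => 1 + (charFun ν l - ν.real Set.univ) / n) ?_ n
    have hn0' : (0 : ℝ) < n := by exact_mod_cast hn0
    have hle : ν.real Set.univ / n ≤ 1 := by
      rw [div_le_one hn0']
      exact hN.trans (by exact_mod_cast hn)
    obtain ⟨c, hc⟩ : ∃ c : NNReal, (c : ℝ) = 1 - ν.real Set.univ / n :=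
      ⟨⟨_, sub_nonneg.2 hle⟩, rfl⟩
    obtain ⟨d, hd⟩ : ∃ d : NNReal, (d : ℝ) = 1 / n := ⟨⟨1 / n, by positivity⟩, rfl⟩
    refine ⟨c • Measure.dirac 0 + d • ν, ⟨?_⟩, funext fun l => ?_⟩
    · rw [← ENNReal.toReal_eq_one_iff, ← measureReal_def, measureReal_add_apply,
        measureReal_nnreal_smul_apply, measureReal_nnreal_smul_apply, hc, hd]
      simp
      ring
    · rw [charFun_apply, integral_add_measure, integral_smul_nnreal_measure,
        integral_smul_nnreal_measure, ← charFun_apply, ← charFun_apply, charFun_dirac]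
      · simp only [NNReal.smul_def, hc, hd, Complex.real_smul]
        simp
        ring
      · exact ((BoundedContinuousFunction.innerProbChar l).integrable _).smul_measure_nnreal
      · exact ((BoundedContinuousFunction.innerProbChar l).integrable _).smul_measure_nnreal
  · have : Continuous (charFun ν) := by fun_prop
    fun_prop

end IsCharFun

/-- The compensated integrand in the Lévy–Khintchine formula. -/
noncomputable def levyIntegrand (l x : ℝ) : ℂ :=
  Complex.exp (Complex.I * (l : ℂ) * (x : ℂ)) - 1 -
    (if |x| ≤ 1 then Complex.I * (l : ℂ) * (x : ℂ) else 0)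

theorem measurable_levyIntegrand (l : ℝ) : Measurable (levyIntegrand l) := by
  unfold levyIntegrand
  refine Measurable.sub (by fun_prop) (Measurable.ite ?_ (by fun_prop) (by fun_prop))
  exact measurableSet_le (by fun_prop) (by fun_prop)

theorem continuous_levyIntegrand_left (x : ℝ) : Continuous (fun l => levyIntegrand l x) := by
  unfold levyIntegrand
  split_ifs <;> fun_prop

/-- The function dominating `levyIntegrand l`, up to a constant depending on `l`. -/
noncomputable def levyBound (r x : ℝ) : ℝ := if |x| ≤ 1 then |x| ^ r else 1

theorem levyBound_nonneg (r x : ℝ) : 0 ≤ levyBound r x := by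
  unfold levyBound
  split_ifs <;> positivity

theorem norm_exp_I_mul_sub_one_sub_le {r : ℝ} (hr1 : 1 ≤ r) (hr2 : r ≤ 2) (y : ℝ) :
    ‖Complex.exp (Complex.I * y) - 1 - Complex.I * y‖ ≤ 3 * |y| ^ r := by
  have hn : ‖Complex.I * (y : ℂ)‖ = |y| := by simp
  rcases le_total |y| 1 with hy | hy
  · have h1 := Complex.norm_exp_sub_one_sub_id_le (x := Complex.I * y) (by rwa [hn])
    rw [hn] at h1
    have h2 : |y| ^ 2 ≤ |y| ^ r := by
      rw [← Real.rpow_two]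
      rcases (abs_nonneg y).eq_or_lt with h0 | h0
      · rw [← h0, Real.zero_rpow (by norm_num), Real.zero_rpow (by linarith)]
      · exact Real.rpow_le_rpow_of_exponent_ge h0 hy hr2
    have h3 : 0 ≤ |y| ^ r := by positivity
    linarith
  · have h1 : ‖Complex.exp (Complex.I * y) - 1 - Complex.I * y‖ ≤ |y| + |y| := by
      refine (norm_sub_le _ _).trans (add_le_add ?_ hn.le)
      simpa using Real.norm_exp_I_mul_ofReal_sub_one_le (x := y)
    have h2 : |y| ≤ |y| ^ r := Real.self_le_rpow_of_one_le hy hr1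
    linarith [abs_nonneg y]

theorem norm_levyIntegrand_le {r : ℝ} (hr1 : 1 ≤ r) (hr2 : r ≤ 2) (l x : ℝ) :
    ‖levyIntegrand l x‖ ≤ 3 * (1 + |l| ^ r) * levyBound r x := by
  have hl : 0 ≤ |l| ^ r := by positivity
  unfold levyIntegrand levyBound
  split_ifs with hx
  · have h := norm_exp_I_mul_sub_one_sub_le hr1 hr2 (l * x)
    rw [abs_mul, Real.mul_rpow (abs_nonneg _) (abs_nonneg _)] at h
    push_cast at h
    rw [← mul_assoc] at h
    have hx' : 0 ≤ |x| ^ r := by positivity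
    nlinarith
  · rw [sub_zero]
    have h : ‖Complex.exp (Complex.I * l * x)‖ = 1 := by
      rw [show Complex.I * l * x = ((l * x : ℝ) : ℂ) * Complex.I by push_cast; ring]
      exact Complex.norm_exp_ofReal_mul_I _
    have h' := norm_sub_le (Complex.exp (Complex.I * l * x)) 1
    rw [h, norm_one] at h'
    linarith

section Exponent

variable {Λ : Measure ℝ} {r : ℝ}

theorem integrable_levyIntegrand (hr1 : 1 ≤ r) (hr2 : r ≤ 2) (hΛ : Integrable (levyBound r) Λ)
    (l : ℝ) : Integrable (levyIntegrand l) Λ :=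
  (hΛ.const_mul _).mono' (measurable_levyIntegrand l).aestronglyMeasurable
    (.of_forall (norm_levyIntegrand_le hr1 hr2 l))

theorem norm_integral_levyIntegrand_le (hr1 : 1 ≤ r) (hr2 : r ≤ 2)
    (hΛ : Integrable (levyBound r) Λ) (l : ℝ) :
    ‖∫ x, levyIntegrand l x ∂Λ‖ ≤ 3 * (1 + |l| ^ r) * ∫ x, levyBound r x ∂Λ := by
  rw [← integral_const_mul]
  exact norm_integral_le_of_norm_le (hΛ.const_mul _)
    (.of_forall (norm_levyIntegrand_le hr1 hr2 l))

theorem continuous_integral_levyIntegrand (hr1 : 1 ≤ r) (hr2 : r ≤ 2)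
    (hΛ : Integrable (levyBound r) Λ) : Continuous (fun l => ∫ x, levyIntegrand l x ∂Λ) := by
  refine continuous_iff_continuousAt.2 fun l₀ => ?_
  refine continuousAt_of_dominated (bound := fun x => 3 * (1 + (|l₀| + 1) ^ r) * levyBound r x)
    (.of_forall fun l => (measurable_levyIntegrand l).aestronglyMeasurable) ?_
    (hΛ.const_mul _) (.of_forall fun x => (continuous_levyIntegrand_left x).continuousAt)
  filter_upwards [Metric.ball_mem_nhds l₀ one_pos] with l hl
  refine .of_forall fun x => (norm_levyIntegrand_le hr1 hr2 l x).trans ?_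
  have hl' : |l| ≤ |l₀| + 1 := by
    rw [Metric.mem_ball, Real.dist_eq] at hl
    linarith [abs_sub_abs_le_abs_sub l l₀]
  have := levyBound_nonneg r x
  gcongr

theorem isCharFun_exp_integral_of_isFiniteMeasure (ν : Measure ℝ) [IsFiniteMeasure ν] :
    IsCharFun (fun l => Complex.exp (∫ x, levyIntegrand l x ∂ν)) := by
  have hm : MeasurableSet {x : ℝ | |x| ≤ 1} := measurableSet_le (by fun_prop) (by fun_prop)
  have hint : IntegrableOn (fun x : ℝ => x) {x : ℝ | |x| ≤ 1} ν := by
    refine Integrable.mono' (integrable_const (1 : ℝ)) (by fun_prop) ?_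
    exact ae_restrict_of_forall_mem hm fun x hx => hx
  convert (IsCharFun.exp_charFun_sub ν).mul
    (IsCharFun.exp_mul_I (-∫ x in {x : ℝ | |x| ≤ 1}, x ∂ν)) using 2 with l
  rw [← Complex.exp_add]
  congr 1
  have h1 : ∀ x : ℝ, levyIntegrand l x = (Complex.exp (l * x * Complex.I) - 1) -
      {x : ℝ | |x| ≤ 1}.indicator (fun x : ℝ => Complex.I * l * x) x := fun x => by
    rw [levyIntegrand, Set.indicator_apply]
    congr 3
    ring
  have hexp : Integrable (fun x : ℝ => Complex.exp (l * x * Complex.I)) ν := by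
    refine Integrable.mono' (integrable_const (1 : ℝ)) (by fun_prop) (.of_forall fun x => ?_)
    rw [← Complex.ofReal_mul, Complex.norm_exp_ofReal_mul_I]
  have hlin : IntegrableOn (fun x : ℝ => Complex.I * l * (x : ℂ)) {x : ℝ | |x| ≤ 1} ν :=
    (Integrable.ofReal hint).const_mul _
  simp_rw [h1]
  rw [integral_sub (f := fun x : ℝ => Complex.exp (l * x * Complex.I) - 1)
      (hexp.sub (integrable_const _)) (hlin.integrable_indicator hm),
    integral_sub hexp (integrable_const _), integral_indicator hm, integral_const_mul,
    integral_complex_ofReal, charFun_apply_real]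
  simp
  ring

theorem isCharFun_exp_integral (hr1 : 1 ≤ r) (hr2 : r ≤ 2) (hΛ : Integrable (levyBound r) Λ)
    {c : ℝ} (hc : 0 ≤ c) :
    IsCharFun (fun l => Complex.exp (c * ∫ x, levyIntegrand l x ∂Λ)) := by
  lift c to NNReal using hc
  let S : ℕ → Set ℝ := fun n => {x | (1 : ℝ) / (n + 1) ≤ |x|}
  have hS : ∀ n, MeasurableSet (S n) := fun n => measurableSet_le (by fun_prop) (by fun_prop)
  have hfin : ∀ n, IsFiniteMeasure (Λ.restrict (S n)) := fun n => by
    refine ⟨?_⟩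
    rw [Measure.restrict_apply_univ]
    have hpos : (0 : ℝ) < 1 / (n + 1) := by positivity
    refine lt_of_le_of_lt (measure_mono fun x hx => ?_)
      (hΛ.measure_ge_lt_top (ε := ((1 : ℝ) / (n + 1)) ^ r) (by positivity))
    have hx' : (1 : ℝ) / (n + 1) ≤ |x| := hx
    show _ ≤ levyBound r x
    unfold levyBound
    split_ifs
    · gcongr
    · refine Real.rpow_le_one hpos.le ?_ (by linarith)
      rw [div_le_one (by positivity)]
      linarith [(Nat.cast_nonneg n : (0 : ℝ) ≤ n)]
  refine IsCharFun.of_tendsto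
    (F := fun n l => Complex.exp (c * ∫ x in S n, levyIntegrand l x ∂Λ)) ?_ ?_ ?_
  · refine .of_forall fun n => ?_
    convert isCharFun_exp_integral_of_isFiniteMeasure (c • Λ.restrict (S n)) using 3 with l
    rw [integral_smul_nnreal_measure, NNReal.smul_def, Complex.real_smul]
  · intro l
    refine (Complex.continuous_exp.tendsto _).comp (Tendsto.const_mul _ ?_)
    simp_rw [← integral_indicator (hS _)]
    refine tendsto_integral_of_dominated_convergence (fun x => ‖levyIntegrand l x‖)
      (fun n => ((measurable_levyIntegrand l).indicator (hS n)).aestronglyMeasurable)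
      (integrable_levyIntegrand hr1 hr2 hΛ l).norm
      (fun n => .of_forall fun x => norm_indicator_le_norm_self _ _) (.of_forall fun x => ?_)
    rcases eq_or_ne x 0 with rfl | hx
    · simp [Set.indicator_apply, levyIntegrand]
    · refine tendsto_const_nhds.congr' ?_
      filter_upwards [(tendsto_one_div_add_atTop_nhds_zero_nat (𝕜 := ℝ)).eventually_le_const
        (abs_pos.2 hx)] with n hn
      rw [Set.indicator_of_mem]
      exact hn
  · exact (Complex.continuous_exp.comp
      ((continuous_integral_levyIntegrand hr1 hr2 hΛ).const_mul _)).continuousAt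

end Exponent

theorem yuleSimonPMF_nonneg {p : ℝ} (hp : 0 < p) (n : ℕ) : 0 ≤ yuleSimonPMF p n := by
  unfold yuleSimonPMF
  have h1 := Real.Gamma_nonneg_of_nonneg (n.cast_nonneg : (0 : ℝ) ≤ n)
  have h2 := Real.Gamma_nonneg_of_nonneg (s := 1 / p + 1) (by positivity)
  have h3 := Real.Gamma_nonneg_of_nonneg (s := (n : ℝ) + 1 / p + 1) (by positivity)
  positivity

theorem Real.Gamma_add_nat_eq_prod {s : ℝ} (hs : 0 < s) (n : ℕ) :
    Real.Gamma (s + n) = Real.Gamma s * ∏ j ∈ Finset.range n, (s + j) := by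
  induction n with
  | zero => simp
  | succ n ih =>
    rw [Finset.prod_range_succ, ← mul_assoc, ← ih, mul_comm _ (s + n),
      ← Real.Gamma_add_one (by positivity)]
    push_cast
    ring_nf

theorem yuleSimonPMF_succ_eq {p : ℝ} (hp : 0 < p) {n : ℕ} (hn : n ≠ 0) :
    yuleSimonPMF p (n + 1) =
      p⁻¹ * (Real.GammaSeq (1 / p + 1) n * (n : ℝ) ^ (-(1 / p + 1))) := by
  set s := 1 / p + 1 with hs
  have hs0 : 0 < s := by positivity
  have hn0 : (0 : ℝ) < n := by positivity
  have hprod : ∏ j ∈ Finset.range (n + 1), (s + j) ≠ 0 :=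
    Finset.prod_ne_zero_iff.2 fun j _ => by positivity
  have hΓ := (Real.Gamma_pos_of_pos hs0).ne'
  have hrpow : (n : ℝ) ^ s ≠ 0 := by positivity
  rw [yuleSimonPMF, ← hs, Real.GammaSeq, Real.rpow_neg hn0.le]
  rw [show ((n + 1 : ℕ) : ℝ) + 1 / p + 1 = s + (n + 1 : ℕ) by rw [hs]; ring,
    Real.Gamma_add_nat_eq_prod hs0, Nat.cast_succ, Real.Gamma_nat_eq_factorial]
  field_simp

theorem summable_yuleSimonPMF_mul_rpow {p r : ℝ} (hp : 0 < p) (hr0 : 0 ≤ r) (hr : r < 1 / p) :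
    Summable (fun n : ℕ => yuleSimonPMF p (n + 1) * ((n : ℝ) + 1) ^ r) := by
  have hsum : Summable (fun n : ℕ => (n : ℝ) ^ (r - (1 / p + 1))) :=
    Real.summable_nat_rpow.2 (by linarith)
  refine summable_of_isBigO_nat hsum ?_
  have hG : (fun n => Real.GammaSeq (1 / p + 1) n) =O[atTop] (fun _ => (1 : ℝ)) :=
    (Real.GammaSeq_tendsto_Gamma _).isBigO_one ℝ
  have h2 : (fun n : ℕ => ((n : ℝ) + 1) ^ r) =O[atTop] (fun n : ℕ => (n : ℝ) ^ r) := by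
    refine Asymptotics.IsBigO.of_bound (2 ^ r) ?_
    filter_upwards [eventually_ge_atTop 1] with n hn
    have hn' : (1 : ℝ) ≤ n := by exact_mod_cast hn
    rw [Real.norm_of_nonneg (by positivity), Real.norm_of_nonneg (by positivity),
      ← Real.mul_rpow (by norm_num) (by positivity)]
    gcongr
    linarith
  have h3 := ((hG.mul (Asymptotics.isBigO_refl (fun n : ℕ => (n : ℝ) ^ (-(1 / p + 1))) atTop)).mul
    h2).const_mul_left p⁻¹
  refine h3.congr' ?_ ?_
  · filter_upwards [eventually_ne_atTop 0] with n hn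
    rw [yuleSimonPMF_succ_eq hp hn]
    ring
  · filter_upwards [eventually_gt_atTop 0] with n hn
    rw [one_mul, ← Real.rpow_add (by exact_mod_cast hn)]
    congr 1
    ring

section Series

variable {Ψ : ℝ → ℂ} {w : ℕ → ℝ} {C r : ℝ}

theorem norm_mul_comp_le (hr : 0 ≤ r) (hw : ∀ n, 0 ≤ w n)
    (hΨ : ∀ l, ‖Ψ l‖ ≤ C * (1 + |l| ^ r)) (n : ℕ) {l M : ℝ} (hl : |l| ≤ M) :
    ‖(w n : ℂ) * Ψ (((n : ℝ) + 1) * l)‖ ≤ C * (1 + M ^ r) * (w n * ((n : ℝ) + 1) ^ r) := by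
  have hC : 0 ≤ C := by
    have h := (norm_nonneg _).trans (hΨ 1)
    norm_num at h
    exact h
  have h1 : (1 : ℝ) ≤ ((n : ℝ) + 1) ^ r :=
    Real.one_le_rpow (by linarith [(Nat.cast_nonneg n : (0 : ℝ) ≤ n)]) hr
  rw [norm_mul, Complex.norm_real, Real.norm_of_nonneg (hw n)]
  calc w n * ‖Ψ (((n : ℝ) + 1) * l)‖
      ≤ w n * (C * (1 + ((n : ℝ) + 1) ^ r * |l| ^ r)) := by
        refine mul_le_mul_of_nonneg_left ((hΨ _).trans_eq ?_) (hw n)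
        rw [abs_mul, abs_of_nonneg (by positivity), Real.mul_rpow (by positivity) (abs_nonneg _)]
    _ ≤ w n * (C * (((n : ℝ) + 1) ^ r + ((n : ℝ) + 1) ^ r * M ^ r)) := by
        have := hw n
        gcongr
    _ = C * (1 + M ^ r) * (w n * ((n : ℝ) + 1) ^ r) := by ring

theorem isCharFun_exp_tsum (hr : 0 ≤ r) (hw : ∀ n, 0 ≤ w n)
    (hsum : Summable fun n : ℕ => w n * ((n : ℝ) + 1) ^ r)
    (hΨ : ∀ l, ‖Ψ l‖ ≤ C * (1 + |l| ^ r)) (hcont : Continuous Ψ)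
    (hexp : ∀ c : ℝ, 0 ≤ c → IsCharFun fun l => Complex.exp (c * Ψ l)) {q : ℝ} (hq : 0 ≤ q) :
    IsCharFun fun l => Complex.exp (q * ∑' n : ℕ, (w n : ℂ) * Ψ (((n : ℝ) + 1) * l)) := by
  refine IsCharFun.of_tendsto (F := fun N l => Complex.exp
    (q * ∑ n ∈ Finset.range N, (w n : ℂ) * Ψ (((n : ℝ) + 1) * l))) (.of_forall fun N => ?_)
    (fun l => ?_) ?_
  · simp_rw [Finset.mul_sum, Complex.exp_sum]
    refine IsCharFun.prod _ fun n _ => ?_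
    convert (hexp (q * w n) (mul_nonneg hq (hw n))).comp_mul ((n : ℝ) + 1) using 3 with l
    push_cast
    ring
  · have h : Summable fun n : ℕ => (w n : ℂ) * Ψ (((n : ℝ) + 1) * l) :=
      .of_norm_bounded (hsum.mul_left _) fun n => norm_mul_comp_le hr hw hΨ n le_rfl
    exact (Complex.continuous_exp.tendsto _).comp (h.hasSum.tendsto_sum_nat.const_mul _)
  · have h : ContinuousOn (fun l => ∑' n : ℕ, (w n : ℂ) * Ψ (((n : ℝ) + 1) * l))
        (Metric.ball 0 1) := by
      refine continuousOn_tsum (fun n => by fun_prop) (hsum.mul_left (C * (1 + 1 ^ r)))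
        fun n l hl => norm_mul_comp_le hr hw hΨ n ?_
      simpa using (mem_ball_zero_iff.1 hl).le
    exact Complex.continuous_exp.continuousAt.comp
      ((h.continuousAt (Metric.ball_mem_nhds 0 one_pos)).const_mul _)

end Series

theorem exists_integrable_levyBound {Λ : Measure ℝ} {b : ℝ} (hb : 1 < b)
    (hΛint : ∫⁻ x : ℝ, ENNReal.ofReal (min (x ^ 2) 1) ∂Λ < ⊤) (hBG : bgIndex Λ < b) :
    ∃ r, 1 ≤ r ∧ r ≤ 2 ∧ r < b ∧ Integrable (levyBound r) Λ := by
  have hm : MeasurableSet (Set.Icc (-1 : ℝ) 1) := measurableSet_Icc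
  have h2 : ∫⁻ x in Set.Icc (-1 : ℝ) 1, ENNReal.ofReal (|x| ^ (2 : ℝ)) ∂Λ < ⊤ := by
    refine lt_of_le_of_lt ((setLIntegral_mono' hm fun x hx => ?_).trans
      (setLIntegral_le_lintegral _ _)) hΛint
    have hx' : x ^ 2 ≤ 1 := by nlinarith [hx.1, hx.2]
    rw [min_eq_left hx', Real.rpow_two, sq_abs]
  obtain ⟨s, ⟨hs0, hs⟩, hsb⟩ := exists_lt_of_csInf_lt (s := {r : ℝ | 0 < r ∧
    ∫⁻ x in Set.Icc (-1 : ℝ) 1, ENNReal.ofReal (|x| ^ r) ∂Λ < ⊤}) ⟨2, two_pos, h2⟩ hBG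
  obtain ⟨r, hr1, hr2, hrb, hr⟩ : ∃ r : ℝ, 1 ≤ r ∧ r ≤ 2 ∧ r < b ∧
      ∫⁻ x in Set.Icc (-1 : ℝ) 1, ENNReal.ofReal (|x| ^ r) ∂Λ < ⊤ := by
    rcases le_total 2 s with h | h
    · exact ⟨2, one_le_two, le_rfl, h.trans_lt hsb, h2⟩
    · refine ⟨max s 1, le_max_right _ _, max_le h one_le_two, max_lt hsb hb,
        lt_of_le_of_lt (setLIntegral_mono' hm fun x hx => ?_) hs⟩
      refine ENNReal.ofReal_le_ofReal ?_
      rcases (abs_nonneg x).eq_or_lt with h0 | h0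
      · rw [← h0, Real.zero_rpow (by positivity), Real.zero_rpow hs0.ne']
      · exact Real.rpow_le_rpow_of_exponent_ge h0 (abs_le.2 hx) (le_max_left _ _)
  have hmeas : Measurable (levyBound r) :=
    Measurable.ite (measurableSet_le (by fun_prop) (by fun_prop)) (by fun_prop) (by fun_prop)
  refine ⟨r, hr1, hr2, hrb, hmeas.aestronglyMeasurable, ?_⟩
  rw [hasFiniteIntegral_iff_ofReal (.of_forall (levyBound_nonneg r)),
    ← lintegral_add_compl _ hm]
  refine ENNReal.add_lt_top.2 ⟨lt_of_le_of_lt (setLIntegral_mono' hm fun x hx => ?_) hr,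
    lt_of_le_of_lt ((setLIntegral_mono' hm.compl fun x hx => ?_).trans
      (setLIntegral_le_lintegral _ _)) hΛint⟩
  · rw [levyBound, if_pos (abs_le.2 hx)]
  · have hx' : ¬ |x| ≤ 1 := fun h => hx (abs_le.1 h)
    rw [levyBound, if_neg hx', min_eq_right]
    rw [← sq_abs]
    nlinarith

/-- Existence of the one-dimensional marginal of a noise reinforced Lévy process with
characteristics `(a, 0, Λ, p)`, for an admissible memory parameter `p` (`β(Λ) < 1/p`):
the series `∑ₖ f_p(k) Ψ(kλ)` converges absolutely, and there is a probability measure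
whose characteristic function equals `exp((1-p) ∑ₖ f_p(k) Ψ(kλ))`. -/
theorem nrlp_marginal_exists
    (p a : ℝ) (hp0 : 0 < p) (hp1 : p < 1)
    (Λ : Measure ℝ) (hΛ0 : Λ {0} = 0)
    (hΛint : ∫⁻ x : ℝ, ENNReal.ofReal (min (x ^ 2) 1) ∂Λ < ⊤)
    (hBG : bgIndex Λ < 1 / p)
    (Ψ : ℝ → ℂ)
    (hΨ : ∀ l : ℝ, Ψ l = Complex.I * (a : ℂ) * (l : ℂ) +
      ∫ x : ℝ, (Complex.exp (Complex.I * (l : ℂ) * (x : ℂ)) - 1 -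
        (if |x| ≤ 1 then Complex.I * (l : ℂ) * (x : ℂ) else 0)) ∂Λ) :
    (∀ l : ℝ, Summable (fun n : ℕ =>
        ‖(yuleSimonPMF p (n + 1) : ℂ) * Ψ (((n : ℝ) + 1) * l)‖)) ∧
      ∃ μhat : Measure ℝ, IsProbabilityMeasure μhat ∧
        ∀ l : ℝ, ∫ x : ℝ, Complex.exp (Complex.I * (l : ℂ) * (x : ℂ)) ∂μhat
          = Complex.exp (((1 - p : ℝ) : ℂ) *
              ∑' n : ℕ, (yuleSimonPMF p (n + 1) : ℂ) * Ψ (((n : ℝ) + 1) * l)) := by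
  obtain ⟨r, hr1, hr2, hrp, hΛ⟩ :=
    exists_integrable_levyBound (by rwa [lt_div_iff₀ hp0, one_mul]) hΛint hBG
  have hr0 : 0 ≤ r := zero_le_one.trans hr1
  replace hΨ : Ψ = fun l : ℝ => Complex.I * a * l + ∫ x, levyIntegrand l x ∂Λ := funext hΨ
  have hbound : ∀ l, ‖Ψ l‖ ≤ (|a| + 3 * ∫ x, levyBound r x ∂Λ) * (1 + |l| ^ r) := fun l => by
    rw [hΨ]
    have h1 : |l| ≤ 1 + |l| ^ r := by
      have : 0 ≤ |l| ^ r := by positivity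
      rcases le_total |l| 1 with h | h
      · linarith
      · linarith [Real.self_le_rpow_of_one_le h hr1]
    have h2 : ‖Complex.I * a * l‖ ≤ |a| * (1 + |l| ^ r) := by
      simpa using mul_le_mul_of_nonneg_left h1 (abs_nonneg a)
    linarith [norm_add_le (Complex.I * a * l) (∫ x, levyIntegrand l x ∂Λ),
      norm_integral_levyIntegrand_le hr1 hr2 hΛ l]
  have hcont : Continuous Ψ := by
    rw [hΨ]
    exact Continuous.add (by fun_prop) (continuous_integral_levyIntegrand hr1 hr2 hΛ)
  have hexp : ∀ c : ℝ, 0 ≤ c → IsCharFun fun l => Complex.exp (c * Ψ l) := fun c hc => by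
    convert (IsCharFun.exp_mul_I (c * a)).mul (isCharFun_exp_integral hr1 hr2 hΛ hc) using 2 with l
    rw [← Complex.exp_add, hΨ]
    congr 1
    push_cast
    ring
  have hw : ∀ n : ℕ, 0 ≤ yuleSimonPMF p (n + 1) := fun n => yuleSimonPMF_nonneg hp0 _
  have hsum := summable_yuleSimonPMF_mul_rpow hp0 hr0 hrp
  refine ⟨fun l => .of_nonneg_of_le (fun _ => norm_nonneg _)
    (fun n => norm_mul_comp_le hr0 hw hbound n le_rfl) (hsum.mul_left _), ?_⟩
  obtain ⟨μ, hμ, h⟩ := isCharFun_exp_tsum hr0 hw hsum hbound hcont hexp (sub_nonneg.2 hp1.le)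
  refine ⟨μ, hμ, fun l => ?_⟩
  rw [← congrFun h l, charFun_apply_real]
  congr 1 with x
  congr 1
  ring
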